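/- arXiv:1711.07354 — 4 statements merged into one kernel-verified Lean document; each statement's English description precedes it below -/
import Mathlib

section
/- Let E be a real inner product space, φ : E → ℝ a convex function, w₀ ∈ E, and suppose ŵ ∈ E minimizes w ↦ φ(w) + (1/2)‖w − w₀‖² over E. Then for every w ∈ E, φ(ŵ) + (1/2)‖ŵ − w₀‖² ≤ φ(w) + (1/2)‖w − w₀‖² − (1/2)‖w − ŵ‖². -/
/-- 3-Point Property: if `φ` is convex and `wHat` minimizes
`w ↦ φ w + (1/2)‖w − w₀‖²` over `E`, then for every `w`,
`φ wHat + (1/2)‖wHat − w₀‖² ≤ φ w + (1/2)‖w − w₀‖² − (1/2)‖w − wHat‖²`. -/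
theorem three_point_property {E : Type*} [NormedAddCommGroup E]
    [InnerProductSpace ℝ E] (φ : E → ℝ) (hφ : ConvexOn ℝ Set.univ φ)
    (w₀ wHat : E)
    (hmin : ∀ w : E,
      φ wHat + (1 / 2) * ‖wHat - w₀‖ ^ 2 ≤ φ w + (1 / 2) * ‖w - w₀‖ ^ 2) :
    ∀ w : E, φ wHat + (1 / 2) * ‖wHat - w₀‖ ^ 2 ≤
      φ w + (1 / 2) * ‖w - w₀‖ ^ 2 - (1 / 2) * ‖w - wHat‖ ^ 2 := by
  intro w
  have expand (t : ℝ) : ‖wHat + t • (w - wHat) - w₀‖ ^ 2 =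
      ‖wHat - w₀‖ ^ 2 + 2 * t * inner ℝ (wHat - w₀) (w - wHat) + t ^ 2 * ‖w - wHat‖ ^ 2 := by
    rw [add_sub_right_comm, norm_add_sq_real, inner_smul_right, norm_smul, mul_pow,
      Real.norm_eq_abs, sq_abs]
    ring
  have expand_one := expand 1
  rw [one_smul, add_sub_cancel] at expand_one
  set D := ‖w - wHat‖ ^ 2
  have hD_nonneg : 0 ≤ D := sq_nonneg _
  set c := φ w - φ wHat + inner ℝ (wHat - w₀) (w - wHat) with hc
  -- Convexity along the segment from `wHat` to `w` bounds the increase of the objective.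
  have increase_nonneg (t : ℝ) (ht₀ : 0 < t) (ht₁ : t ≤ 1) : 0 ≤ c + t / 2 * D := by
    have hconv := hφ.2 (Set.mem_univ wHat) (Set.mem_univ w) (sub_nonneg.2 ht₁) ht₀.le
      (sub_add_cancel 1 t)
    have hpoint : (1 - t) • wHat + t • w = wHat + t • (w - wHat) := by module
    rw [hpoint, smul_eq_mul, smul_eq_mul] at hconv
    have hle := hmin (wHat + t • (w - wHat))
    rw [expand t] at hle
    refine nonneg_of_mul_nonneg_right ?_ ht₀
    rw [hc]
    linarith
  have hc_nonneg : 0 ≤ c := by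
    by_contra! hneg
    have hpos : 0 < D - c := by linarith
    have h := increase_nonneg (-c / (D - c)) (div_pos (neg_pos.2 hneg) hpos)
      ((div_le_one hpos).2 (by linarith))
    have heq : c + -c / (D - c) / 2 * D = c * (D - 2 * c) / (2 * (D - c)) := by
      field_simp
      ring
    rw [heq] at h
    exact h.not_gt (div_neg_of_neg_of_pos (mul_neg_of_neg_of_pos hneg (by linarith))
      (by linarith))
  linarith
end

section
/- Let X be a nonempty closed convex subset of a real inner product space, φ : X → ℝ a convex function, and θ ∈ (0, 1]. Let x ∈ X and suppose x̂ ∈ X minimizes z ↦ φ(z) + (1/2)‖z − y‖² over X, where y = (1 − θ) x + θ x̂ (so y ∈ X). Then ((1 − θ)/θ) ‖y − x‖² ≤ φ(x) − φ(y). -/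
/-- The three-point property of a proximal point: if `p` minimizes
`z ↦ φ z + (1/2)‖z - c‖²` over the domain `X` of a convex function `φ`, then the minimal value
is exceeded at every `z ∈ X` by at least `(1/2)‖z - p‖²`. -/
theorem ConvexOn.prox_three_point {E : Type*} [NormedAddCommGroup E] [InnerProductSpace ℝ E]
    {X : Set E} {φ : E → ℝ} (hφ : ConvexOn ℝ X φ) {c p z : E} (hp : p ∈ X) (hz : z ∈ X)
    (hmin : ∀ w ∈ X, φ p + (1 / 2) * ‖p - c‖ ^ 2 ≤ φ w + (1 / 2) * ‖w - c‖ ^ 2) :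
    φ p + (1 / 2) * ‖p - c‖ ^ 2 + (1 / 2) * ‖z - p‖ ^ 2 ≤ φ z + (1 / 2) * ‖z - c‖ ^ 2 := by
  have norm_segment (t : ℝ) : ‖(1 - t) • p + t • z - c‖ ^ 2 =
      ‖p - c‖ ^ 2 + 2 * t * inner ℝ (p - c) (z - p) + t ^ 2 * ‖z - p‖ ^ 2 := by
    rw [show (1 - t) • p + t • z - c = (p - c) + t • (z - p) by module, norm_add_sq_real,
      inner_smul_right, norm_smul, mul_pow, Real.norm_eq_abs, sq_abs]
    ring
  have first_order : 0 ≤ φ z - φ p + inner ℝ (p - c) (z - p) := by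
    have slope (t : ℝ) (ht : t ∈ Set.Ioc (0 : ℝ) 1) :
        0 ≤ φ z - φ p + inner ℝ (p - c) (z - p) + t * ((1 / 2) * ‖z - p‖ ^ 2) := by
      have ht' : 0 ≤ 1 - t := sub_nonneg.2 ht.2
      have hconv := hφ.2 hp hz ht' ht.1.le (by ring)
      have hle := hmin _ (hφ.1 hp hz ht' ht.1.le (by ring))
      rw [norm_segment] at hle
      simp only [smul_eq_mul] at hconv
      refine (mul_nonneg_iff_of_pos_left ht.1).1 ?_
      linarith
    have hlim : Filter.Tendsto
        (fun t : ℝ ↦ φ z - φ p + inner ℝ (p - c) (z - p) + t * ((1 / 2) * ‖z - p‖ ^ 2))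
        (nhdsWithin 0 (Set.Ioi 0)) (nhds (φ z - φ p + inner ℝ (p - c) (z - p))) := by
      refine Filter.Tendsto.mono_left ?_ nhdsWithin_le_nhds
      exact Continuous.tendsto' (by fun_prop) _ _ (by simp)
    exact ge_of_tendsto hlim (Filter.mem_of_superset (Ioc_mem_nhdsGT one_pos) slope)
  have hz_norm := norm_segment 1
  simp only [sub_self, zero_smul, one_smul, zero_add] at hz_norm
  rw [hz_norm]
  linarith

/-- First inequality of Lemma 2: for `θ ∈ (0, 1]`, `x ∈ X`, `y = (1−θ)x + θx̂`
with `x̂` minimizing `z ↦ φ z + (1/2)‖z − y‖²` over the nonempty closed convex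
set `X`, one has `((1 − θ)/θ)‖y − x‖² ≤ φ x − φ y`. -/
theorem prox_combination_decrease {E : Type*} [NormedAddCommGroup E]
    [InnerProductSpace ℝ E] (X : Set E) (hX : X.Nonempty) (hXc : IsClosed X)
    (hXconv : Convex ℝ X) (φ : E → ℝ) (hφ : ConvexOn ℝ X φ)
    (θ : ℝ) (hθ0 : 0 < θ) (hθ1 : θ ≤ 1)
    (x xHat : E) (hx : x ∈ X) (hxHat : xHat ∈ X)
    (y : E) (hy : y = (1 - θ) • x + θ • xHat)
    (hmin : ∀ z ∈ X,
      φ xHat + (1 / 2) * ‖xHat - y‖ ^ 2 ≤ φ z + (1 / 2) * ‖z - y‖ ^ 2) :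
    ((1 - θ) / θ) * ‖y - x‖ ^ 2 ≤ φ x - φ y := by
  have hconv := hφ.2 hx hxHat (sub_nonneg.2 hθ1) hθ0.le (by ring)
  rw [← hy] at hconv
  simp only [smul_eq_mul] at hconv
  have three_point := hφ.prox_three_point hxHat hx hmin
  have norm_sq_smul (a : ℝ) : ‖a • (x - xHat)‖ ^ 2 = a ^ 2 * ‖x - xHat‖ ^ 2 := by
    rw [norm_smul, mul_pow, Real.norm_eq_abs, sq_abs]
  rw [show xHat - y = (-(1 - θ)) • (x - xHat) by rw [hy]; module,
    show x - y = θ • (x - xHat) by rw [hy]; module, norm_sq_smul, norm_sq_smul] at three_point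
  rw [show y - x = (-θ) • (x - xHat) by rw [hy]; module, norm_sq_smul]
  have decrease : (1 - θ) * ‖x - xHat‖ ^ 2 ≤ φ x - φ xHat := by linarith
  calc (1 - θ) / θ * ((-θ) ^ 2 * ‖x - xHat‖ ^ 2)
      = θ * ((1 - θ) * ‖x - xHat‖ ^ 2) := by field_simp
    _ ≤ θ * (φ x - φ xHat) := mul_le_mul_of_nonneg_left decrease hθ0.le
    _ ≤ φ x - φ y := by linarith
end

section
/- Let X be a nonempty closed convex subset of a real inner product space, φ : X → ℝ a convex function that is Lipschitz continuous with constant L ≥ 0, and θ ∈ (0, 1). Let x ∈ X and suppose x̂ ∈ X minimizes z ↦ φ(z) + (1/2)‖z − y‖² over X, where y = (1 − θ) x + θ x̂. Then ((1 − θ)/θ) ‖y − x‖² ≤ φ(x) − φ(y) ≤ L ‖y − x‖, and consequently ‖y − x‖ ≤ L θ / (1 − θ). -/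
open Filter Topology in
/-- The variational inequality satisfied by a proximal point `p` of a convex function `φ` with
center `c` over a set `X`. -/
theorem ConvexOn.inner_le_sub_of_isProx {E : Type*} [NormedAddCommGroup E]
    [InnerProductSpace ℝ E] {X : Set E} {φ : E → ℝ} (hφ : ConvexOn ℝ X φ) {c p z : E}
    (hp : p ∈ X) (hz : z ∈ X)
    (hmin : ∀ w ∈ X, φ p + (1 / 2) * ‖p - c‖ ^ 2 ≤ φ w + (1 / 2) * ‖w - c‖ ^ 2) :
    inner ℝ (c - p) (z - p) ≤ φ z - φ p := by
  have segment_bound : ∀ t : ℝ, 0 < t → t < 1 →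
      inner ℝ (c - p) (z - p) ≤ φ z - φ p + t * (‖z - p‖ ^ 2 / 2) := by
    intro t ht0 ht1
    have hw := hmin _ (hφ.1 hp hz (sub_nonneg.2 ht1.le) ht0.le (sub_add_cancel 1 t))
    have hconv := hφ.2 hp hz (sub_nonneg.2 ht1.le) ht0.le (sub_add_cancel 1 t)
    have hdecomp : (1 - t) • p + t • z - c = t • (z - p) - (c - p) := by module
    rw [hdecomp, norm_sub_sq_real (t • (z - p)), norm_smul, Real.norm_of_nonneg ht0.le,
      real_inner_smul_left, real_inner_comm, norm_sub_rev c p] at hw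
    simp only [smul_eq_mul] at hconv
    refine le_of_mul_le_mul_left ?_ ht0
    linarith
  have hlim : Tendsto (fun t : ℝ => φ z - φ p + t * (‖z - p‖ ^ 2 / 2)) (𝓝[>] 0)
      (𝓝 (φ z - φ p)) := by
    refine Tendsto.mono_left ?_ nhdsWithin_le_nhds
    exact Continuous.tendsto' (by fun_prop) _ _ (by simp)
  refine ge_of_tendsto hlim ?_
  filter_upwards [Ioo_mem_nhdsGT (zero_lt_one' ℝ)] with t ht
  exact segment_bound t ht.1 ht.2

/-- Lemma 2: for `θ ∈ (0, 1)`, `x ∈ X`, `y = (1−θ)x + θx̂` with `x̂` the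
proximal point of the convex, `L`-Lipschitz function `φ` (center `y`) over the
nonempty closed convex set `X`:
`((1 − θ)/θ)‖y − x‖² ≤ φ x − φ y ≤ L‖y − x‖`, hence `‖y − x‖ ≤ Lθ/(1 − θ)`. -/
theorem prox_combination_step_bound {E : Type*} [NormedAddCommGroup E]
    [InnerProductSpace ℝ E] (X : Set E) (hX : X.Nonempty) (hXc : IsClosed X)
    (hXconv : Convex ℝ X) (φ : E → ℝ) (hφ : ConvexOn ℝ X φ)
    (L : ℝ) (hL : 0 ≤ L)
    (hLip : ∀ x₁ ∈ X, ∀ x₂ ∈ X, |φ x₁ - φ x₂| ≤ L * ‖x₁ - x₂‖)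
    (θ : ℝ) (hθ0 : 0 < θ) (hθ1 : θ < 1)
    (x xHat : E) (hx : x ∈ X) (hxHat : xHat ∈ X)
    (y : E) (hy : y = (1 - θ) • x + θ • xHat)
    (hmin : ∀ z ∈ X,
      φ xHat + (1 / 2) * ‖xHat - y‖ ^ 2 ≤ φ z + (1 / 2) * ‖z - y‖ ^ 2) :
    ((1 - θ) / θ) * ‖y - x‖ ^ 2 ≤ φ x - φ y ∧
      φ x - φ y ≤ L * ‖y - x‖ ∧
      ‖y - x‖ ≤ L * θ / (1 - θ) := by
  have hθ1' : 0 < 1 - θ := sub_pos.2 hθ1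
  have hyX : y ∈ X := hy ▸ hXconv hx hxHat hθ1'.le hθ0.le (sub_add_cancel 1 θ)
  have hstep : ‖y - x‖ = θ * ‖x - xHat‖ := by
    rw [show y - x = θ • (xHat - x) by rw [hy]; module, norm_smul,
      Real.norm_of_nonneg hθ0.le, norm_sub_rev]
  have hprox : (1 - θ) * ‖x - xHat‖ ^ 2 ≤ φ x - φ xHat := by
    have h := hφ.inner_le_sub_of_isProx hxHat hx hmin
    rwa [show y - xHat = (1 - θ) • (x - xHat) by rw [hy]; module, real_inner_smul_left,
      real_inner_self_eq_norm_sq] at h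
  have hconv : φ y ≤ (1 - θ) * φ x + θ * φ xHat :=
    hy ▸ hφ.2 hx hxHat hθ1'.le hθ0.le (sub_add_cancel 1 θ)
  have hlower : ((1 - θ) / θ) * ‖y - x‖ ^ 2 ≤ φ x - φ y := by
    have heq : ((1 - θ) / θ) * ‖y - x‖ ^ 2 = θ * ((1 - θ) * ‖x - xHat‖ ^ 2) := by
      rw [hstep]
      field_simp
    rw [heq]
    linarith [mul_le_mul_of_nonneg_left hprox hθ0.le]
  have hupper : φ x - φ y ≤ L * ‖y - x‖ := by
    rw [norm_sub_rev]
    exact (le_abs_self _).trans (hLip x hx y hyX)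
  refine ⟨hlower, hupper, ?_⟩
  rcases (norm_nonneg (y - x)).eq_or_lt with h0 | hpos
  · rw [← h0]
    positivity
  · have h := hlower.trans hupper
    rw [pow_two, ← mul_assoc] at h
    have h' := le_of_mul_le_mul_right h hpos
    rw [div_mul_eq_mul_div, div_le_iff₀ hθ0] at h'
    rw [le_div_iff₀ hθ1', mul_comm]
    exact h'
end

section
/- Let X be a nonempty closed convex subset of a real inner product space, φ : X → ℝ a convex function, and θ ∈ (0, 1). Let x ∈ X and suppose x̂ ∈ X minimizes z ↦ φ(z) + (1/2)‖z − y‖² over X, where y = (1 − θ) x + θ x̂. Then φ(x) = φ(y) if and only if x̂ = x (equivalently, if and only if y = x); in particular, if x̂ ≠ x then φ(y) < φ(x), so the update strictly decreases φ. -/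
/-- Inside the proof of Lemma 2: with `θ ∈ (0,1)`, `y = (1−θ)x + θx̂` and
`x̂` the proximal point of the convex function `φ` (center `y`) over the
nonempty closed convex set `X`, one has `φ x = φ y ↔ x̂ = x`,
`x̂ = x ↔ y = x`, and if `x̂ ≠ x` then `φ y < φ x`. -/
theorem prox_combination_strict_decrease {E : Type*} [NormedAddCommGroup E]
    [InnerProductSpace ℝ E] (X : Set E) (hX : X.Nonempty) (hXc : IsClosed X)
    (hXconv : Convex ℝ X) (φ : E → ℝ) (hφ : ConvexOn ℝ X φ)
    (θ : ℝ) (hθ0 : 0 < θ) (hθ1 : θ < 1)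
    (x xHat : E) (hx : x ∈ X) (hxHat : xHat ∈ X)
    (y : E) (hy : y = (1 - θ) • x + θ • xHat)
    (hmin : ∀ z ∈ X,
      φ xHat + (1 / 2) * ‖xHat - y‖ ^ 2 ≤ φ z + (1 / 2) * ‖z - y‖ ^ 2) :
    (φ x = φ y ↔ xHat = x) ∧ (xHat = x ↔ y = x) ∧
      (xHat ≠ x → φ y < φ x) := by
  have hsub : y - x = θ • (xHat - x) := by rw [hy]; module
  have hsub' : xHat - y = (1 - θ) • (xHat - x) := by rw [hy]; module
  have hyx : xHat = x ↔ y = x := by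
    rw [← sub_eq_zero (a := y), hsub, smul_eq_zero_iff_right hθ0.ne', sub_eq_zero]
  have hdecrease : xHat ≠ x → φ y < φ x := by
    intro hne
    have hyX : y ∈ X := hy ▸ hXconv hx hxHat (by linarith) hθ0.le (by ring)
    have hconv : φ y ≤ (1 - θ) * φ x + θ * φ xHat := by
      simpa [hy] using hφ.2 hx hxHat (by linarith : 0 ≤ 1 - θ) hθ0.le (by ring)
    have hprox : φ xHat + (1 / 2) * ‖xHat - y‖ ^ 2 ≤ φ y := by
      simpa using hmin y hyX
    have hpos : 0 < ‖xHat - y‖ := by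
      rw [norm_pos_iff, hsub']
      exact smul_ne_zero (by linarith) (sub_ne_zero.mpr hne)
    have hlt : φ xHat < φ y := by nlinarith
    nlinarith
  refine ⟨⟨fun h => ?_, fun h => by rw [hyx.mp h]⟩, hyx, hdecrease⟩
  by_contra hne
  exact (hdecrease hne).ne' h
end
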